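/- Let 0 ≤ a < b ≤ 1 and consider the restricted Bernoulli channel B|_{[a,b]} whose code words are required to have all letters in [a,b]. Then for every λ₁, λ₂ > 0 with λ₁ + λ₂ < 1, 1/4 ≤ liminf_{n→∞} (1/(n log₂ n)) · log₂ N_DI(n,λ₁,λ₂) and limsup_{n→∞} (1/(n log₂ n)) · log₂ N_DI(n,λ₁,λ₂) ≤ 1/2, where N_DI(n,λ₁,λ₂) is the maximal size of an (n,N,λ₁,λ₂)-DI code for B|_{[a,b]}. -/

import Mathlib

open Real Filter

namespace Bern

/-- The Bernoulli output distribution `B_x` on `{0,1} ≅ Bool`: `B_x(1) = x`, `B_x(0) = 1−x`. -/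
noncomputable def bern (x : ℝ) : Bool → ℝ := fun y => if y then x else 1 - x

/-- Product Bernoulli distribution `B_{x^n}` on `{0,1}^n`. -/
noncomputable def bprod {n : ℕ} (u : Fin n → ℝ) (y : Fin n → Bool) : ℝ :=
  ∏ i, bern (u i) (y i)

/-- Probability of a set of output words under `B_{x^n}`. -/
noncomputable def bprob {n : ℕ} (u : Fin n → ℝ) (E : Finset (Fin n → Bool)) : ℝ :=
  ∑ y ∈ E, bprod u y

/-- An `(n,N,λ₁,λ₂)`-deterministic identification code for the Bernoulli channel restricted
to input letters in `S ⊆ [0,1]`. -/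
def bernCode (S : Set ℝ) (n N : ℕ) (l1 l2 : ℝ) : Prop :=
  ∃ (u : Fin N → Fin n → ℝ) (E : Fin N → Finset (Fin n → Bool)),
    (∀ j i, u j i ∈ S) ∧
    (∀ j, 1 - l1 ≤ bprob (u j) (E j)) ∧
    (∀ j k, j ≠ k → bprob (u j) (E k) ≤ l2)

end Bern

open Bern


namespace Bern

lemma bern_nonneg {x : ℝ} (hx : x ∈ Set.Icc (0:ℝ) 1) (y : Bool) : 0 ≤ bern x y := by
  obtain ⟨h0, h1⟩ := hx
  cases y <;> simp [bern] <;> linarith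

lemma bprod_nonneg {n : ℕ} {u : Fin n → ℝ} (hu : ∀ i, u i ∈ Set.Icc (0:ℝ) 1)
    (y : Fin n → Bool) : 0 ≤ bprod u y :=
  Finset.prod_nonneg fun i _ => bern_nonneg (hu i) _

lemma sum_prod_pi {n : ℕ} (f : Fin n → Bool → ℝ) :
    ∑ y : Fin n → Bool, ∏ i, f i (y i) = ∏ i, (f i true + f i false) := by
  have h := Finset.prod_univ_sum (fun _ : Fin n => (Finset.univ : Finset Bool)) f
  simp only [Fintype.piFinset_univ, Fintype.sum_bool] at h
  exact h.symm

lemma sum_bprod {n : ℕ} (u : Fin n → ℝ) : ∑ y : Fin n → Bool, bprod u y = 1 := by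
  unfold bprod
  rw [sum_prod_pi (fun i => bern (u i))]
  simp [bern]

noncomputable def aff (x y : ℝ) : ℝ := √x * √y + √(1 - x) * √(1 - y)

lemma sum_sqrt {n : ℕ} {u v : Fin n → ℝ} (hu : ∀ i, u i ∈ Set.Icc (0:ℝ) 1)
    (hv : ∀ i, v i ∈ Set.Icc (0:ℝ) 1) :
    ∑ y : Fin n → Bool, √(bprod u y) * √(bprod v y) = ∏ i, aff (u i) (v i) := by
  have : ∀ y : Fin n → Bool, √(bprod u y) * √(bprod v y)
      = ∏ i, (fun i b => √(bern (u i) b) * √(bern (v i) b)) i (y i) := by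
    intro y
    unfold bprod
    rw [Finset.prod_mul_distrib, Real.sqrt_prod, Real.sqrt_prod]
    · intro i _; exact bern_nonneg (hv i) _
    · intro i _; exact bern_nonneg (hu i) _
  rw [Finset.sum_congr rfl (fun y _ => this y),
    sum_prod_pi (fun i b => √(bern (u i) b) * √(bern (v i) b))]
  simp [bern, aff]

lemma aff_nonneg (x y : ℝ) : 0 ≤ aff x y := by unfold aff; positivity

lemma aff_le {x y : ℝ} (hx : x ∈ Set.Icc (0:ℝ) 1) (hy : y ∈ Set.Icc (0:ℝ) 1) :
    aff x y ≤ 1 - (x - y) ^ 2 / 8 := by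
  obtain ⟨hx0, hx1⟩ := hx
  obtain ⟨hy0, hy1⟩ := hy
  unfold aff
  have a1 := Real.sq_sqrt hx0
  have a2 := Real.sq_sqrt hy0
  have a3 := Real.sq_sqrt (sub_nonneg.2 hx1)
  have a4 := Real.sq_sqrt (sub_nonneg.2 hy1)
  have b1 : √x ≤ 1 := Real.sqrt_le_one.2 hx1
  have b2 : √y ≤ 1 := Real.sqrt_le_one.2 hy1
  have c1 := Real.sqrt_nonneg x
  have c2 := Real.sqrt_nonneg y
  have e : (x - y) ^ 2 = (√x - √y) ^ 2 * (√x + √y) ^ 2 := by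
    have : x - y = (√x - √y) * (√x + √y) := by nlinarith
    rw [this]; ring
  have e2 : (√x + √y) ^ 2 ≤ 4 := by nlinarith
  have e3 : (x - y) ^ 2 ≤ 4 * (√x - √y) ^ 2 := by
    rw [e]; nlinarith [sq_nonneg (√x - √y)]
  nlinarith [sq_nonneg (√(1-x) - √(1-y))]

lemma aff_eq_cos {x y : ℝ} (hx : x ∈ Set.Icc (0:ℝ) 1) (hy : y ∈ Set.Icc (0:ℝ) 1) :
    aff x y = Real.cos (Real.arcsin √x - Real.arcsin √y) := by
  obtain ⟨hx0, hx1⟩ := hx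
  obtain ⟨hy0, hy1⟩ := hy
  have b1 : √x ≤ 1 := Real.sqrt_le_one.2 hx1
  have b2 : √y ≤ 1 := Real.sqrt_le_one.2 hy1
  have c1 := Real.sqrt_nonneg x
  have c2 := Real.sqrt_nonneg y
  rw [Real.cos_sub, Real.sin_arcsin (by linarith) b1, Real.sin_arcsin (by linarith) b2,
    Real.cos_arcsin, Real.cos_arcsin, Real.sq_sqrt hx0, Real.sq_sqrt hy0]
  unfold aff; ring

/-- total variation bound -/
lemma bprob_sub_le {n : ℕ} {u v : Fin n → ℝ} (hu : ∀ i, u i ∈ Set.Icc (0:ℝ) 1)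
    (hv : ∀ i, v i ∈ Set.Icc (0:ℝ) 1) (E : Finset (Fin n → Bool)) :
    (bprob u E - bprob v E) ^ 2 ≤ 8 * (1 - ∏ i, aff (u i) (v i)) := by
  set F := ∏ i, aff (u i) (v i) with hF
  have hs := sum_sqrt hu hv
  have hpu := sum_bprod u
  have hpv := sum_bprod v
  have F1 : ∑ y : Fin n → Bool, (√(bprod u y) - √(bprod v y)) ^ 2 = 2 - 2 * F := by
    have : ∀ y : Fin n → Bool, (√(bprod u y) - √(bprod v y)) ^ 2
      = bprod u y + bprod v y - 2 * (√(bprod u y) * √(bprod v y)) := by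
      intro y
      have a1 := Real.sq_sqrt (bprod_nonneg hu y)
      have a2 := Real.sq_sqrt (bprod_nonneg hv y)
      linear_combination a1 + a2
    rw [Finset.sum_congr rfl (fun y _ => this y), Finset.sum_sub_distrib, Finset.sum_add_distrib,
      ← Finset.mul_sum, hs, hpu, hpv]; ring
  have F2 : ∑ y : Fin n → Bool, (√(bprod u y) + √(bprod v y)) ^ 2 = 2 + 2 * F := by
    have : ∀ y : Fin n → Bool, (√(bprod u y) + √(bprod v y)) ^ 2
      = bprod u y + bprod v y + 2 * (√(bprod u y) * √(bprod v y)) := by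
      intro y
      have a1 := Real.sq_sqrt (bprod_nonneg hu y)
      have a2 := Real.sq_sqrt (bprod_nonneg hv y)
      linear_combination a1 + a2
    rw [Finset.sum_congr rfl (fun y _ => this y), Finset.sum_add_distrib, Finset.sum_add_distrib,
      ← Finset.mul_sum, hs, hpu, hpv]; ring
  have hle : F ≤ 1 := by
    have : 0 ≤ ∑ y : Fin n → Bool, (√(bprod u y) - √(bprod v y)) ^ 2 :=
      Finset.sum_nonneg fun y _ => sq_nonneg _
    linarith
  have e : bprob u E - bprob v E
      = ∑ y ∈ E, (√(bprod u y) - √(bprod v y)) * (√(bprod u y) + √(bprod v y)) := by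
    unfold bprob
    rw [← Finset.sum_sub_distrib]
    refine Finset.sum_congr rfl fun y _ => ?_
    have a1 := Real.sq_sqrt (bprod_nonneg hu y)
    have a2 := Real.sq_sqrt (bprod_nonneg hv y)
    linear_combination a2 - a1
  rw [e]
  refine (Finset.sum_mul_sq_le_sq_mul_sq _ _ _).trans ?_
  have g1 : ∑ y ∈ E, (√(bprod u y) - √(bprod v y)) ^ 2 ≤ 2 - 2 * F := by
    rw [← F1]
    exact Finset.sum_le_sum_of_subset_of_nonneg (Finset.subset_univ _) fun _ _ _ => sq_nonneg _
  have g2 : ∑ y ∈ E, (√(bprod u y) + √(bprod v y)) ^ 2 ≤ 4 := by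
    have : ∑ y ∈ E, (√(bprod u y) + √(bprod v y)) ^ 2 ≤ 2 + 2 * F := by
      rw [← F2]
      exact Finset.sum_le_sum_of_subset_of_nonneg (Finset.subset_univ _) fun _ _ _ => sq_nonneg _
    linarith
  calc _ ≤ (2 - 2 * F) * 4 := mul_le_mul g1 g2 (Finset.sum_nonneg fun y _ => sq_nonneg _)
          (by linarith)
    _ = _ := by ring

lemma one_sub_prod_le {n : ℕ} (f : Fin n → ℝ) (d : ℝ) (h0 : ∀ i, 0 ≤ f i) (h1 : ∀ i, f i ≤ 1)
    (hd : ∀ i, 1 - f i ≤ d) : 1 - ∏ i, f i ≤ n * d := by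
  have key : ∀ s : Finset (Fin n), 1 - ∏ i ∈ s, f i ≤ s.card * d := by
    intro s
    induction s using Finset.induction_on with
    | empty => simp
    | insert i s hi ih =>
      rw [Finset.prod_insert hi, Finset.card_insert_of_notMem hi]
      push_cast
      have p1 : ∏ i ∈ s, f i ≤ 1 := Finset.prod_le_one (fun i _ => h0 i) (fun i _ => h1 i)
      nlinarith [hd i, h0 i, h1 i]
  simpa using key Finset.univ

lemma upper_core {S : Set ℝ} (hS : S ⊆ Set.Icc 0 1) {n N M : ℕ} {l1 l2 : ℝ}
    (h12 : l1 + l2 < 1)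
    (hM : 4 * (n:ℝ) < (M:ℝ) ^ 2 * (1 - l1 - l2) ^ 2) (hc : bernCode S n N l1 l2) :
    N ≤ (2 * M + 1) ^ n := by
  obtain ⟨u, E, hu, hE1, hE2⟩ := hc
  have hM0 : (0:ℝ) < M := by
    rcases Nat.eq_zero_or_pos M with h | h
    · subst h
      have : (0:ℝ) ≤ n := Nat.cast_nonneg n
      norm_num at hM; linarith
    · exact_mod_cast h
  let θ : Fin N → Fin n → ℝ := fun j i => Real.arcsin √(u j i)
  have hθ0 : ∀ j i, 0 ≤ θ j i := fun j i => Real.arcsin_nonneg.2 (Real.sqrt_nonneg _)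
  have hθ1 : ∀ j i, θ j i ≤ 2 := fun j i =>
    (Real.arcsin_le_pi_div_two _).trans (by linarith [Real.pi_le_four])
  have hlt : ∀ j i, ⌊θ j i * M⌋₊ < 2 * M + 1 := by
    intro j i
    rw [Nat.lt_succ_iff]
    apply Nat.floor_le_of_le
    push_cast
    exact mul_le_mul_of_nonneg_right (hθ1 j i) hM0.le
  let φ : Fin N → Fin n → Fin (2 * M + 1) := fun j i => ⟨⌊θ j i * M⌋₊, hlt j i⟩
  have hinj : Function.Injective φ := by
    intro j k hjk
    by_contra hne
    have hu' : ∀ j i, u j i ∈ Set.Icc (0:ℝ) 1 := fun j i => hS (hu j i)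
    have hb := bprob_sub_le (hu' j) (hu' k) (E j)
    have h1 := hE1 j
    have h2 := hE2 k j (Ne.symm hne)
    have hF : 1 - ∏ i, aff (u j i) (u k i) ≤ n * (1 / (2 * (M:ℝ) ^ 2)) := by
      apply one_sub_prod_le
      · intro i; exact aff_nonneg _ _
      · intro i; exact (aff_le (hu' j i) (hu' k i)).trans (by nlinarith [sq_nonneg (u j i - u k i)])
      · intro i
        rw [aff_eq_cos (hu' j i) (hu' k i)]
        have hfl : ⌊θ j i * M⌋₊ = ⌊θ k i * M⌋₊ := by
          have := congrFun hjk i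
          simpa [φ] using this
        have a1 := Nat.floor_le (mul_nonneg (hθ0 j i) hM0.le)
        have a2 := Nat.lt_floor_add_one (θ j i * M)
        have a3 := Nat.floor_le (mul_nonneg (hθ0 k i) hM0.le)
        have a4 := Nat.lt_floor_add_one (θ k i * M)
        rw [hfl] at a1 a2
        have hc := Real.one_sub_sq_div_two_le_cos (x := θ j i - θ k i)
        have hsq : ((θ j i - θ k i) * M) ^ 2 ≤ 1 := by
          rw [sq_le_one_iff_abs_le_one, abs_le]
          constructor <;> nlinarith
        have : (θ j i - θ k i) ^ 2 / 2 ≤ 1 / (2 * (M:ℝ) ^ 2) := by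
          rw [div_le_div_iff₀ (by norm_num) (by positivity)]
          nlinarith
        change 1 - Real.cos (θ j i - θ k i) ≤ _
        linarith
    have hη : (1 - l1 - l2) ^ 2 ≤ (bprob (u j) (E j) - bprob (u k) (E j)) ^ 2 := by
      apply pow_le_pow_left₀ <;> linarith
    have : (1 - l1 - l2) ^ 2 ≤ 8 * (n * (1 / (2 * (M:ℝ) ^ 2))) := by linarith
    have h3 : 8 * (n * (1 / (2 * (M:ℝ) ^ 2))) * (M:ℝ) ^ 2 = 4 * n := by
      field_simp; ring
    nlinarith [sq_nonneg (M:ℝ)]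
  have := Fintype.card_le_of_injective φ hinj
  simpa using this

end Bern

namespace Bern

lemma second_moment {n : ℕ} (p g : Fin n → Bool → ℝ) (C : ℝ) (hp : ∀ i b, 0 ≤ p i b)
    (hp1 : ∀ i, p i true + p i false = 1)
    (hg0 : ∀ i, p i true * g i true + p i false * g i false = 0)
    (hgC : ∀ i b, (g i b) ^ 2 ≤ C ^ 2) :
    ∑ y : Fin n → Bool, (∏ i, p i (y i)) * (∑ i, g i (y i)) ^ 2 ≤ n * C ^ 2 := by
  have e : ∀ y : Fin n → Bool, (∏ i, p i (y i)) * (∑ i, g i (y i)) ^ 2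
      = ∑ i, ∑ k, ∏ m, (p m (y m) * (if m = i then g m (y m) else 1)
          * (if m = k then g m (y m) else 1)) := by
    intro y
    rw [sq, Finset.sum_mul_sum, Finset.mul_sum]
    refine Finset.sum_congr rfl fun i _ => ?_
    rw [Finset.mul_sum]
    refine Finset.sum_congr rfl fun k _ => ?_
    rw [Finset.prod_mul_distrib, Finset.prod_mul_distrib]
    simp [mul_assoc]
  rw [Finset.sum_congr rfl (fun y _ => e y), Finset.sum_comm]
  have : ∀ i : Fin n, ∑ y : Fin n → Bool, ∑ k, ∏ m, (p m (y m) * (if m = i then g m (y m) else 1)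
          * (if m = k then g m (y m) else 1)) ≤ C ^ 2 := by
    intro i
    rw [Finset.sum_comm]
    rw [Finset.sum_eq_single i]
    · rw [sum_prod_pi (fun m b => p m b * (if m = i then g m b else 1)
          * (if m = i then g m b else 1))]
      rw [Finset.prod_eq_single i]
      · simp only [if_true]
        have h1 := hp1 i
        nlinarith [mul_le_mul_of_nonneg_left (hgC i true) (hp i true),
          mul_le_mul_of_nonneg_left (hgC i false) (hp i false)]
      · intro m _ hm
        simp [hm, hp1]
      · simp
    · intro k _ hk
      rw [sum_prod_pi (fun m b => p m b * (if m = i then g m b else 1)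
          * (if m = k then g m b else 1))]
      apply Finset.prod_eq_zero (Finset.mem_univ i)
      simp [Ne.symm hk, hg0]
    · simp
  calc _ ≤ ∑ i : Fin n, C ^ 2 := Finset.sum_le_sum fun i _ => this i
    _ = _ := by simp

noncomputable def nent (x : ℝ) : ℝ := x * Real.log x + (1 - x) * Real.log (1 - x)

noncomputable def nH {n : ℕ} (u : Fin n → ℝ) : ℝ := ∑ i, nent (u i)

open Classical in
noncomputable def typ {n : ℕ} (u : Fin n → ℝ) (R : ℝ) : Finset (Fin n → Bool) :=
  Finset.univ.filter fun y => |Real.log (bprod u y) - nH u| ≤ R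

lemma log_mem {α x : ℝ} (h0 : 0 < α) (hx : x ∈ Set.Icc α (1 - α)) :
    Real.log x ∈ Set.Icc (Real.log α) 0 ∧ Real.log (1 - x) ∈ Set.Icc (Real.log α) 0 := by
  obtain ⟨h1, h2⟩ := hx
  exact ⟨⟨Real.log_le_log h0 h1, Real.log_nonpos (by linarith) (by linarith)⟩,
    ⟨Real.log_le_log h0 (by linarith), Real.log_nonpos (by linarith) (by linarith)⟩⟩

lemma nent_mem {α x : ℝ} (h0 : 0 < α) (hx : x ∈ Set.Icc α (1 - α)) :
    nent x ∈ Set.Icc (Real.log α) 0 := by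
  obtain ⟨⟨a, b⟩, c, d⟩ := log_mem h0 hx
  obtain ⟨h1, h2⟩ := hx
  unfold nent
  constructor <;> nlinarith

lemma bern_pos {α x : ℝ} (h0 : 0 < α) (hx : x ∈ Set.Icc α (1 - α)) (b : Bool) :
    0 < bern x b := by
  obtain ⟨h1, h2⟩ := hx
  cases b <;> simp [bern] <;> linarith

lemma compl_typ {n : ℕ} {u : Fin n → ℝ} {α K : ℝ} (hn : 0 < n) (h0 : 0 < α)
    (hu : ∀ i, u i ∈ Set.Icc α (1 - α)) (hK : 0 < K) :
    1 - bprob u (typ u (K * √n)) ≤ (Real.log α) ^ 2 / K ^ 2 := by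
  classical
  have hpos : ∀ y, 0 < bprod u y := fun y => Finset.prod_pos fun i _ => bern_pos h0 (hu i) _
  have hn' : (0:ℝ) < n := by exact_mod_cast hn
  have hm := second_moment (fun i => bern (u i)) (fun i b => Real.log (bern (u i) b) - nent (u i))
    (Real.log α) (fun i b => (bern_pos h0 (hu i) b).le) (fun i => by simp [bern])
    (fun i => by simp [bern, nent]; ring)
    (fun i b => by
      obtain ⟨⟨a, b'⟩, c, d⟩ := log_mem h0 (hu i)
      obtain ⟨e, f⟩ := nent_mem h0 (hu i)
      have : |Real.log (bern (u i) b) - nent (u i)| ≤ |Real.log α| := by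
        rw [abs_of_nonpos (e.trans f), abs_le]
        cases b <;> simp [bern] <;> constructor <;> linarith
      exact sq_le_sq.2 this)
  have e : ∀ y : Fin n → Bool, ∑ i, (Real.log (bern (u i) (y i)) - nent (u i))
      = Real.log (bprod u y) - nH u := by
    intro y
    rw [Finset.sum_sub_distrib]
    unfold bprod nH
    rw [Real.log_prod (fun i _ => (bern_pos h0 (hu i) _).ne')]
  simp only [e] at hm
  change ∑ y, bprod u y * _ ≤ _ at hm
  have hs := sum_bprod u
  have hc : 1 - bprob u (typ u (K * √n)) = ∑ y ∈ (typ u (K * √n))ᶜ, bprod u y := by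
    unfold bprob
    rw [← hs, ← Finset.sum_add_sum_compl (typ u (K * √n)) (bprod u)]; ring
  rw [hc, le_div_iff₀ (by positivity), Finset.sum_mul]
  have h3 : ∀ y ∈ (typ u (K * √n))ᶜ, bprod u y * K ^ 2 * n ≤
      bprod u y * (Real.log (bprod u y) - nH u) ^ 2 := by
    intro y hy
    simp only [typ, Finset.mem_compl, Finset.mem_filter, Finset.mem_univ, true_and, not_le] at hy
    rw [mul_assoc]
    apply mul_le_mul_of_nonneg_left _ (hpos y).le
    rw [← sq_abs (_ - _)]
    calc K ^ 2 * n = (K * √n) ^ 2 := by rw [mul_pow, Real.sq_sqrt hn'.le]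
      _ ≤ _ := pow_le_pow_left₀ (by positivity) hy.le 2
  have h4 : (∑ y ∈ (typ u (K * √n))ᶜ, bprod u y * K ^ 2) * n ≤ n * (Real.log α) ^ 2 := by
    rw [Finset.sum_mul]
    refine (Finset.sum_le_sum h3).trans (le_trans ?_ hm)
    exact Finset.sum_le_sum_of_subset_of_nonneg (Finset.subset_univ _)
      fun y _ _ => mul_nonneg (hpos y).le (sq_nonneg _)
  nlinarith

lemma prod_aff_le {n : ℕ} {u v : Fin n → ℝ} (hu : ∀ i, u i ∈ Set.Icc (0:ℝ) 1)
    (hv : ∀ i, v i ∈ Set.Icc (0:ℝ) 1) :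
    ∏ i, aff (u i) (v i) ≤ Real.exp (-(∑ i, (u i - v i) ^ 2) / 8) := by
  rw [neg_div, Finset.sum_div, ← Finset.sum_neg_distrib, Real.exp_sum]
  apply Finset.prod_le_prod (fun i _ => aff_nonneg _ _)
  intro i _
  have := Real.add_one_le_exp (-((u i - v i) ^ 2 / 8))
  linarith [aff_le (hu i) (hv i)]

lemma cross_typ {n : ℕ} {u v : Fin n → ℝ} {α K D : ℝ} (hn : 0 < n) (h0 : 0 < α)
    (hu : ∀ i, u i ∈ Set.Icc α (1 - α)) (hv : ∀ i, v i ∈ Set.Icc α (1 - α)) (hK : 0 < K)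
    (hH : |nH u - nH v| ≤ √n) (hD : D * √n ≤ ∑ i, (u i - v i) ^ 2) :
    bprob u (typ v (K * √n)) ≤ (Real.log α) ^ 2 / K ^ 2 + Real.exp ((K + 1/2 - D / 8) * √n) := by
  classical
  have hposu : ∀ y, 0 < bprod u y := fun y => Finset.prod_pos fun i _ => bern_pos h0 (hu i) _
  have hposv : ∀ y, 0 < bprod v y := fun y => Finset.prod_pos fun i _ => bern_pos h0 (hv i) _
  have hu' : ∀ i, u i ∈ Set.Icc (0:ℝ) 1 := fun i => ⟨by linarith [(hu i).1], by linarith [(hu i).2]⟩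
  have hv' : ∀ i, v i ∈ Set.Icc (0:ℝ) 1 := fun i => ⟨by linarith [(hv i).1], by linarith [(hv i).2]⟩
  have h1 := compl_typ hn h0 hu hK
  have hs := sum_bprod u
  have hc : 1 - bprob u (typ u (K * √n)) = ∑ y ∈ (typ u (K * √n))ᶜ, bprod u y := by
    unfold bprob
    rw [← hs, ← Finset.sum_add_sum_compl (typ u (K * √n)) (bprod u)]; ring
  have hsplit : bprob u (typ v (K * √n)) ≤ ∑ y ∈ (typ u (K * √n))ᶜ, bprod u y
      + ∑ y ∈ typ v (K * √n) ∩ typ u (K * √n), bprod u y := by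
    unfold bprob
    rw [← Finset.sum_inter_add_sum_sdiff (typ v (K * √n)) (typ u (K * √n)), add_comm]
    gcongr
    · intro y _ _; exact (hposu y).le
    · intro y hy; simp at hy ⊢; exact hy.2
  have h2 : ∑ y ∈ typ v (K * √n) ∩ typ u (K * √n), bprod u y
      ≤ ∑ y ∈ typ v (K * √n) ∩ typ u (K * √n),
        Real.exp ((K + 1/2) * √n) * (√(bprod u y) * √(bprod v y)) := by
    refine Finset.sum_le_sum fun y hy => ?_
    simp only [typ, Finset.mem_inter, Finset.mem_filter, Finset.mem_univ, true_and] at hy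
    obtain ⟨hy1, hy2⟩ := hy
    rw [abs_le] at hy1 hy2 hH
    have hlog : Real.log (bprod u y) ≤ (2 * K + 1) * √n + Real.log (bprod v y) := by linarith
    have hsq : ∀ x : ℝ, 0 < x → √x = Real.exp (Real.log x / 2) := by
      intro x hx
      rw [Real.exp_half, Real.exp_log hx]
    rw [hsq _ (hposu y), hsq _ (hposv y), ← Real.exp_add, ← Real.exp_add]
    nth_rewrite 1 [← Real.exp_log (hposu y)]
    apply Real.exp_le_exp.2
    linarith
  have h3 : ∑ y ∈ typ v (K * √n) ∩ typ u (K * √n),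
        Real.exp ((K + 1/2) * √n) * (√(bprod u y) * √(bprod v y))
      ≤ Real.exp ((K + 1/2 - D / 8) * √n) := by
    rw [← Finset.mul_sum]
    have : ∑ y ∈ typ v (K * √n) ∩ typ u (K * √n), (√(bprod u y) * √(bprod v y))
        ≤ Real.exp (-(D * √n) / 8) := by
      refine (Finset.sum_le_sum_of_subset_of_nonneg (Finset.subset_univ _)
        fun y _ _ => by positivity).trans ?_
      rw [sum_sqrt hu' hv']
      refine (prod_aff_le hu' hv').trans ?_
      apply Real.exp_le_exp.2
      linarith
    calc _ ≤ Real.exp ((K + 1/2) * √n) * Real.exp (-(D * √n) / 8) :=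
          mul_le_mul_of_nonneg_left this (Real.exp_pos _).le
      _ = _ := by rw [← Real.exp_add]; congr 1; ring
  linarith

/-- ball size in Hamming space -/
lemma ball_card {n q r : ℕ} (hq : 0 < q) (w : Fin n → Fin q) :
    (Finset.univ.filter fun w' : Fin n → Fin q => hammingDist w w' ≤ r).card ≤ 2 ^ n * q ^ r := by
  classical
  have hsub : (Finset.univ.filter fun w' : Fin n → Fin q => hammingDist w w' ≤ r) ⊆
      ((Finset.univ : Finset (Finset (Fin n))).filter fun A => A.card ≤ r).biUnion fun A =>
        Fintype.piFinset fun i => if i ∈ A then Finset.univ else {w i} := by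
    intro w' hw'
    simp only [Finset.mem_filter, Finset.mem_univ, true_and] at hw'
    simp only [Finset.mem_biUnion, Finset.mem_filter, Finset.mem_univ, true_and,
      Fintype.mem_piFinset]
    refine ⟨Finset.univ.filter fun i => w i ≠ w' i, hw', fun i => ?_⟩
    by_cases h : w i = w' i
    · simp [h]
    · simp [h]
  refine (Finset.card_le_card hsub).trans ?_
  refine (Finset.card_biUnion_le_card_mul _ _ (q ^ r) ?_).trans ?_
  · intro A hA
    simp only [Finset.mem_filter, Finset.mem_univ, true_and] at hA
    rw [Fintype.card_piFinset]
    have : ∀ i, (if i ∈ A then (Finset.univ : Finset (Fin q)) else {w i}).card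
        = if i ∈ A then q else 1 := by
      intro i; split_ifs <;> simp
    rw [Finset.prod_congr rfl (fun i _ => this i)]
    simp only [Finset.prod_ite_mem, Finset.univ_inter, Finset.prod_const]
    exact Nat.pow_le_pow_right hq hA
  · apply Nat.mul_le_mul_right
    refine (Finset.card_filter_le _ _).trans ?_
    simp

lemma packing {n q r : ℕ} (hq : 0 < q) (S : Finset (Fin n → Fin q)) :
    ∃ T ⊆ S, (∀ w ∈ T, ∀ w' ∈ T, w ≠ w' → r < hammingDist w w') ∧
      S.card ≤ T.card * (2 ^ n * q ^ r) := by
  classical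
  obtain ⟨T, hT, hmax⟩ := Finset.exists_max_image
    (S.powerset.filter fun T => ∀ w ∈ T, ∀ w' ∈ T, w ≠ w' → r < hammingDist w w')
    Finset.card ⟨∅, by simp⟩
  simp only [Finset.mem_filter, Finset.mem_powerset] at hT hmax
  refine ⟨T, hT.1, hT.2, ?_⟩
  have hsub : S ⊆ T.biUnion fun w => Finset.univ.filter fun w' => hammingDist w w' ≤ r := by
    intro x hx
    simp only [Finset.mem_biUnion, Finset.mem_filter, Finset.mem_univ, true_and]
    by_contra! hcon
    have hxT : x ∉ T := fun h => by
      have := hcon x h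
      simp at this
    have := hmax (insert x T) ⟨Finset.insert_subset hx hT.1, by
      intro w hw w' hw' hne
      rw [Finset.mem_insert] at hw hw'
      rcases hw with rfl | hw <;> rcases hw' with rfl | hw'
      · exact absurd rfl hne
      · rw [hammingDist_comm]; exact hcon _ hw'
      · exact hcon _ hw
      · exact hT.2 _ hw _ hw' hne⟩
    rw [Finset.card_insert_of_notMem hxT] at this
    omega
  refine (Finset.card_le_card hsub).trans ?_
  exact Finset.card_biUnion_le_card_mul _ _ _ fun w _ => ball_card hq w

lemma lower_core {S : Set ℝ} {n q r : ℕ} {α K D δ ρ l1 l2 : ℝ} (hn : 0 < n) (hq : 0 < q)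
    (h0 : 0 < α) (hK : 0 < K) (hδ : 0 < δ) (x : Fin q → ℝ)
    (hxS : ∀ k, x k ∈ S) (hxα : ∀ k, x k ∈ Set.Icc α (1 - α))
    (hsep : ∀ k k', k ≠ k' → δ ≤ |x k - x k'|)
    (hr : ρ * n ≤ r + 1)
    (hD : D * √n ≤ ρ * n * δ ^ 2)
    (hl1 : (Real.log α) ^ 2 / K ^ 2 ≤ l1)
    (hl2 : (Real.log α) ^ 2 / K ^ 2 + Real.exp ((K + 1/2 - D / 8) * √n) ≤ l2) :
    ∃ N : ℕ, bernCode S n N l1 l2 ∧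
      (q:ℝ) ^ n ≤ ((2 - Real.log α) * n) * (N * (2 ^ n * q ^ r)) := by
  classical
  have hn' : (0:ℝ) < n := by exact_mod_cast hn
  have hsn : 0 < √(n:ℝ) := Real.sqrt_pos.2 hn'
  let U : (Fin n → Fin q) → Fin n → ℝ := fun w i => x (w i)
  have hlogα : Real.log α ≤ 0 := by
    have := hxα ⟨0, hq⟩
    exact Real.log_nonpos h0.le (by linarith [this.1, this.2])
  have hH : ∀ w, nH (U w) ∈ Set.Icc (n * Real.log α) 0 := by
    intro w
    constructor
    · calc n * Real.log α = ∑ i : Fin n, Real.log α := by simp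
        _ ≤ _ := Finset.sum_le_sum fun i _ => (nent_mem h0 (hxα _)).1
    · exact Finset.sum_nonpos fun i _ => (nent_mem h0 (hxα _)).2
  let f : (Fin n → Fin q) → ℤ := fun w => ⌊nH (U w) / √n⌋
  let t : Finset ℤ := Finset.Icc ⌊√n * Real.log α⌋ 0
  have hft : ∀ w ∈ (Finset.univ : Finset (Fin n → Fin q)), f w ∈ t := by
    intro w _
    simp only [f, t, Finset.mem_Icc]
    constructor
    · apply Int.floor_le_floor
      rw [le_div_iff₀ hsn]
      calc √n * Real.log α * √n = (√n * √n) * Real.log α := by ring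
        _ = n * Real.log α := by rw [Real.mul_self_sqrt hn'.le]
        _ ≤ _ := (hH w).1
    · have : nH (U w) / √n ≤ 0 := div_nonpos_of_nonpos_of_nonneg (hH w).2 hsn.le
      have h := Int.floor_le (nH (U w) / √n)
      have : ((⌊nH (U w) / √n⌋ : ℤ) : ℝ) ≤ 0 := h.trans this
      exact_mod_cast this
  have hfl0 : ⌊√n * Real.log α⌋ ≤ 0 := by
    have : √n * Real.log α ≤ 0 := mul_nonpos_of_nonneg_of_nonpos hsn.le hlogα
    have h := Int.floor_le (√n * Real.log α)
    have : ((⌊√n * Real.log α⌋ : ℤ) : ℝ) ≤ 0 := h.trans this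
    exact_mod_cast this
  have htne : t.Nonempty := ⟨0, by simp only [t, Finset.mem_Icc]; exact ⟨hfl0, le_rfl⟩⟩
  have htcard0 : (0:ℝ) < t.card := by exact_mod_cast htne.card_pos
  have hsn1 : √(n:ℝ) ≤ n := by
    rw [Real.sqrt_le_left hn'.le]
    have : (1:ℝ) ≤ n := by exact_mod_cast hn
    nlinarith
  have htcard : (t.card : ℝ) ≤ (2 - Real.log α) * n := by
    have h1 : (t.card : ℤ) = 0 + 1 - ⌊√n * Real.log α⌋ := by
      simp only [t]
      exact Int.card_Icc_of_le _ _ (by omega)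
    have h2 : (t.card : ℝ) = 1 - (⌊√n * Real.log α⌋ : ℝ) := by
      have : ((t.card : ℤ) : ℝ) = ((0 + 1 - ⌊√n * Real.log α⌋ : ℤ) : ℝ) := by rw [h1]
      push_cast at this
      linarith
    have h3 := Int.lt_floor_add_one (√n * Real.log α)
    have : (1:ℝ) ≤ n := by exact_mod_cast hn
    nlinarith
  obtain ⟨y, _, hy⟩ := Finset.exists_le_card_fiber_of_nsmul_le_card_of_maps_to
    (b := (q:ℝ) ^ n / t.card) hft htne (by
      rw [nsmul_eq_mul, mul_div_cancel₀ _ htcard0.ne']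
      simp)
  obtain ⟨T, hTS, hT1, hT2⟩ := packing (r := r) hq (Finset.univ.filter fun w => f w = y)
  have hTf : ∀ w ∈ T, f w = y := fun w hw => (Finset.mem_filter.1 (hTS hw)).2
  refine ⟨T.card, ?_, ?_⟩
  · let e := T.equivFin.symm
    refine ⟨fun j => U (e j), fun j => typ (U (e j)) (K * √n), fun j i => hxS _, fun j => ?_,
      fun j k hjk => ?_⟩
    · have := compl_typ (u := U (e j)) hn h0 (fun i => hxα _) hK
      linarith
    · refine le_trans (cross_typ (D := D) hn h0 (fun i => hxα _) (fun i => hxα _) hK ?_ ?_) hl2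
      · have h1 := hTf _ (e j).2
        have h2 := hTf _ (e k).2
        have h3 : |nH (U (e j)) / √n - nH (U (e k)) / √n| < 1 :=
          Int.abs_sub_lt_one_of_floor_eq_floor (h1.trans h2.symm)
        rw [← sub_div, abs_div, abs_of_pos hsn, div_lt_one hsn] at h3
        exact h3.le
      · refine hD.trans ?_
        have hne : ((e j : Fin n → Fin q)) ≠ e k := fun h => hjk (e.injective (Subtype.ext h))
        have hd := hT1 _ (e j).2 _ (e k).2 hne
        have hd' : (r:ℝ) + 1 ≤ hammingDist (e j : Fin n → Fin q) (e k) := by exact_mod_cast hd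
        calc ρ * n * δ ^ 2 ≤ (hammingDist (e j : Fin n → Fin q) (e k) : ℝ) * δ ^ 2 := by
              gcongr; linarith
          _ = ∑ i ∈ Finset.univ.filter
                (fun i => (e j : Fin n → Fin q) i ≠ (e k : Fin n → Fin q) i), δ ^ 2 := by
              rw [Finset.sum_const, nsmul_eq_mul]; rfl
          _ ≤ ∑ i ∈ Finset.univ.filter
                (fun i => (e j : Fin n → Fin q) i ≠ (e k : Fin n → Fin q) i),
                (U (e j) i - U (e k) i) ^ 2 := by
              refine Finset.sum_le_sum fun i hi => ?_
              rw [← sq_abs (_ - _)]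
              exact pow_le_pow_left₀ hδ.le (hsep _ _ (Finset.mem_filter.1 hi).2) 2
          _ ≤ _ := Finset.sum_le_sum_of_subset_of_nonneg (Finset.subset_univ _)
                fun _ _ _ => sq_nonneg _
  · rw [div_le_iff₀ htcard0] at hy
    have hT2' : ((Finset.univ.filter fun w => f w = y).card : ℝ)
        ≤ T.card * (2 ^ n * q ^ r) := by exact_mod_cast hT2
    calc (q:ℝ) ^ n ≤ _ := hy
      _ ≤ (T.card * (2 ^ n * q ^ r)) * ((2 - Real.log α) * n) := by gcongr
      _ = _ := by ring

end Bern

namespace Bern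

lemma upper_asym {S : Set ℝ} (hS : S ⊆ Set.Icc 0 1) {l1 l2 : ℝ} (h12 : l1 + l2 < 1) :
    ∃ A : ℝ, ∀ n N : ℕ, 0 < n → bernCode S n N l1 l2 →
      Real.log N ≤ n * (A + 1 / 2 * Real.log n) := by
  set η := 1 - l1 - l2 with hη
  have hη0 : 0 < η := by linarith
  refine ⟨Real.log (6 / η + 3), fun n N hn hc => ?_⟩
  have hn1 : (1:ℝ) ≤ n := by exact_mod_cast hn
  have hs1 : 1 ≤ √(n:ℝ) := Real.one_le_sqrt.2 hn1
  have hle := Nat.le_ceil (3 * √(n:ℝ) / η)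
  have hlt := Nat.ceil_lt_add_one (a := 3 * √(n:ℝ) / η) (by positivity)
  set M := ⌈3 * √(n:ℝ) / η⌉₊ with hM
  have hN := upper_core (M := M) hS h12 (by
    rw [div_le_iff₀ hη0] at hle
    have h3 : (3 * √(n:ℝ)) ^ 2 ≤ (M * η) ^ 2 := pow_le_pow_left₀ (by positivity) hle 2
    rw [mul_pow, Real.sq_sqrt (by linarith), mul_pow] at h3
    linarith) hc
  have hA : (2 * (M:ℝ) + 1) ≤ (6 / η + 3) * √n := by
    have : (6 / η + 3) * √n = 2 * (3 * √n / η) + 3 * √n := by ring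
    linarith
  have hlogA : 0 ≤ n * Real.log (2 * (M:ℝ) + 1) :=
    mul_nonneg (by linarith) (Real.log_nonneg (by linarith [(Nat.cast_nonneg M : (0:ℝ) ≤ M)]))
  have h1 : Real.log N ≤ n * Real.log (2 * (M:ℝ) + 1) := by
    rcases Nat.eq_zero_or_pos N with h | h
    · subst h; simpa using hlogA
    · rw [← Real.log_pow]
      apply Real.log_le_log (by exact_mod_cast h)
      exact_mod_cast hN
  refine h1.trans ?_
  apply mul_le_mul_of_nonneg_left _ (by linarith)
  calc Real.log (2 * (M:ℝ) + 1) ≤ Real.log ((6 / η + 3) * √n) :=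
        Real.log_le_log (by positivity) hA
    _ = _ := by
      rw [Real.log_mul (by positivity) (by positivity), Real.log_sqrt (by linarith)]; ring

lemma lower_asym {a b : ℝ} (ha : 0 ≤ a) (hab : a < b) (hb : b ≤ 1) {l1 l2 ρ : ℝ}
    (h1 : 0 < l1) (h2 : 0 < l2) (hρ : 0 < ρ) (hρ1 : ρ < 1) :
    ∃ A : ℝ, ∀ᶠ n : ℕ in atTop, ∃ N : ℕ, 0 < N ∧ bernCode (Set.Icc a b) n N l1 l2 ∧
      n * ((1 - ρ) / 4 * Real.log n - A) ≤ Real.log N := by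
  set α := (b - a) / 3 with hα
  have hα0 : 0 < α := by linarith
  set m := min l1 (l2 / 2) with hm
  have hm0 : 0 < m := lt_min h1 (by linarith)
  set K := |Real.log α| / √m + 1 with hK
  have hK0 : 0 < K := by positivity
  have hKm : (Real.log α) ^ 2 / K ^ 2 ≤ m := by
    rw [div_le_iff₀ (by positivity)]
    have hsm : 0 < √m := Real.sqrt_pos.2 hm0
    have : |Real.log α| ≤ √m * K := by
      rw [hK, mul_add, mul_div_cancel₀ _ hsm.ne']; linarith
    have h3 := pow_le_pow_left₀ (abs_nonneg _) this 2
    rwa [sq_abs, mul_pow, Real.sq_sqrt hm0.le] at h3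
  have hml1 : m ≤ l1 := min_le_left _ _
  have hml2 : m ≤ l2 / 2 := min_le_right _ _
  set D := 8 * (K + 3 / 2) with hD
  have hD0 : 0 < D := by positivity
  refine ⟨(1 - ρ) * (1 / 2 * Real.log (D / ρ) - Real.log (α / 2))
    + Real.log 2 + (2 - Real.log α), ?_⟩
  have hsq : Tendsto (fun n : ℕ => √(n:ℝ)) atTop atTop :=
    Real.tendsto_sqrt_atTop.comp tendsto_natCast_atTop_atTop
  filter_upwards [eventually_gt_atTop 0, hsq.eventually_ge_atTop (D / (ρ * α ^ 2)),
    hsq.eventually_ge_atTop (-Real.log (l2 / 2))] with n hn he1 he2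
  have hn0 : (0:ℝ) < n := by exact_mod_cast hn
  have hsn : 0 < √(n:ℝ) := Real.sqrt_pos.2 hn0
  set δ := √(D / ρ / √n) with hδ
  have hδ0 : 0 < δ := by positivity
  have hδ2 : δ ^ 2 = D / ρ / √n := Real.sq_sqrt (by positivity)
  have hδα : δ ≤ α := by
    apply Real.sqrt_le_iff.2 ⟨hα0.le, ?_⟩
    rw [div_le_iff₀ hsn, div_le_iff₀ hρ]
    rw [div_le_iff₀ (by positivity)] at he1
    linarith
  have hx1 : 1 ≤ α / δ := (one_le_div hδ0).2 hδα
  set q := ⌊α / δ⌋₊ with hq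
  have hq0 : 0 < q := Nat.floor_pos.2 hx1
  have hq1 : (1:ℝ) ≤ q := by exact_mod_cast hq0
  have hqle : (q:ℝ) ≤ α / δ := Nat.floor_le (by positivity)
  have hqge : α / 2 / δ ≤ q := by
    have := Nat.lt_floor_add_one (α / δ)
    have e : α / 2 / δ = (α / δ) / 2 := by ring
    rw [e]; linarith
  have hlogq : Real.log (α / 2) - 1 / 2 * Real.log (D / ρ) + 1 / 4 * Real.log n ≤ Real.log q := by
    have := Real.log_le_log (by positivity) hqge
    rw [Real.log_div (by positivity) hδ0.ne', hδ, Real.log_sqrt (by positivity),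
      Real.log_div (by positivity) hsn.ne', Real.log_sqrt hn0.le] at this
    linarith
  have hρn : 0 ≤ ρ * n := by positivity
  have hx : ∀ k : Fin q, a + α + δ * k ∈ Set.Icc (a + α) (b - α) := by
    intro k
    have hk : (k:ℝ) ≤ q := by exact_mod_cast k.2.le
    rw [le_div_iff₀ hδ0] at hqle
    have : 0 ≤ δ * (k:ℝ) := by positivity
    constructor
    · linarith
    · nlinarith
  obtain ⟨N, hN, hNq⟩ := lower_core (S := Set.Icc a b) (n := n) (q := q) (r := ⌊ρ * n⌋₊) (α := α)
    (K := K) (D := D) (δ := δ) (ρ := ρ) (l1 := l1) (l2 := l2) hn hq0 hα0 hK0 hδ0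
    (fun k => a + α + δ * k)
    (fun k => ⟨by linarith [(hx k).1], by linarith [(hx k).2]⟩)
    (fun k => ⟨by linarith [(hx k).1], by linarith [(hx k).2]⟩)
    (fun k k' hne => by
      have e : a + α + δ * k - (a + α + δ * k') = δ * (((k:ℤ) - (k':ℤ) : ℤ) : ℝ) := by
        push_cast; ring
      rw [e, abs_mul, abs_of_pos hδ0]
      have hz : ((k:ℤ) - (k':ℤ)) ≠ 0 := by
        intro h
        apply hne
        apply Fin.ext
        omega
      have : (1:ℝ) ≤ |(((k:ℤ) - (k':ℤ) : ℤ) : ℝ)| := by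
        exact_mod_cast Int.one_le_abs hz
      nlinarith)
    (Nat.lt_floor_add_one _).le
    (by
      rw [hδ2]
      have : ρ * n * (D / ρ / √n) = D * (n / √n) := by field_simp
      rw [this, Real.div_sqrt])
    (hKm.trans hml1)
    (by
      have : Real.exp ((K + 1/2 - D / 8) * √n) ≤ l2 / 2 := by
        rw [← Real.le_log_iff_exp_le (by positivity)]
        have : (K + 1/2 - D / 8) * √n = - √n := by rw [hD]; ring
        linarith
      linarith)
  have hNpos : 0 < N := by
    rcases Nat.eq_zero_or_pos N with h | h
    · subst h
      have : (0:ℝ) < (q:ℝ) ^ n := by positivity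
      simp at hNq
      linarith
    · exact h
  have hN0 : (0:ℝ) < N := by exact_mod_cast hNpos
  refine ⟨N, hNpos, hN, ?_⟩
  have hlα : Real.log α ≤ 0 := Real.log_nonpos hα0.le (by linarith)
  have hc0 : 0 < (2 - Real.log α) * n := mul_pos (by linarith) hn0
  have hq0' : (0:ℝ) < q := by linarith
  have hlog := Real.log_le_log (by positivity) hNq
  rw [Real.log_mul hc0.ne' (by positivity), Real.log_mul hN0.ne' (by positivity),
    Real.log_mul (x := 2 ^ n) (by positivity) (by positivity), Real.log_pow, Real.log_pow,
    Real.log_pow] at hlog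
  have h5 : Real.log ((2 - Real.log α) * n) ≤ (2 - Real.log α) * n :=
    (Real.log_le_sub_one_of_pos hc0).trans (by linarith)
  have hlq0 : 0 ≤ Real.log q := Real.log_nonneg hq1
  have h6 : (⌊ρ * n⌋₊ : ℝ) * Real.log q ≤ ρ * n * Real.log q :=
    mul_le_mul_of_nonneg_right (Nat.floor_le hρn) hlq0
  have h7 := mul_le_mul_of_nonneg_left hlogq (mul_nonneg hn0.le (sub_nonneg.2 hρ1.le))
  linarith

end Bern

/-- Corollary (DI capacity bounds for the Bernoulli channel restricted to `[a,b]`): if `N n`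
is the maximal size of an `(n,N,λ₁,λ₂)`-DI code for `B|_{[a,b]}`, then
`1/4 ≤ liminf log₂ N(n)/(n log₂ n)` and `limsup log₂ N(n)/(n log₂ n) ≤ 1/2`. -/
theorem stmt8 (a b : ℝ) (ha : 0 ≤ a) (hab : a < b) (hb : b ≤ 1)
    (l1 l2 : ℝ) (h1 : 0 < l1) (h2 : 0 < l2) (h12 : l1 + l2 < 1)
    (N : ℕ → ℕ)
    (hN : ∀ n, IsGreatest {m : ℕ | bernCode (Set.Icc a b) n m l1 l2} (N n)) :
    (1 / 4 : ℝ) ≤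
        Filter.liminf (fun n : ℕ =>
          Real.logb 2 (N n) / ((n : ℝ) * Real.logb 2 n)) Filter.atTop ∧
      Filter.limsup (fun n : ℕ =>
          Real.logb 2 (N n) / ((n : ℝ) * Real.logb 2 n)) Filter.atTop ≤ (1 / 2 : ℝ) := by
  have hS : Set.Icc a b ⊆ Set.Icc (0:ℝ) 1 := Set.Icc_subset_Icc ha hb
  set f : ℕ → ℝ := fun n : ℕ => Real.logb 2 (N n) / ((n : ℝ) * Real.logb 2 n) with hf
  have hfe : ∀ n, f n = Real.log (N n) / (n * Real.log n) := by
    intro n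
    have : Real.log 2 ≠ 0 := (Real.log_pos (by norm_num)).ne'
    simp only [hf, Real.logb]
    rw [← mul_div_assoc, div_div_div_cancel_right₀ this]
  have hlogt : Tendsto (fun n : ℕ => Real.log (n:ℝ)) atTop atTop :=
    Real.tendsto_log_atTop.comp tendsto_natCast_atTop_atTop
  have hup : ∀ c : ℝ, 1 / 2 < c → ∀ᶠ n in atTop, f n ≤ c := by
    intro c hc
    obtain ⟨A, hA⟩ := upper_asym hS h12
    filter_upwards [eventually_gt_atTop 0, hlogt.eventually_gt_atTop 0,
      hlogt.eventually_ge_atTop (A / (c - 1 / 2))] with n hn hl hl2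
    have hn0 : (0:ℝ) < n := by exact_mod_cast hn
    rw [hfe, div_le_iff₀ (by positivity)]
    refine (hA n (N n) hn (hN n).1).trans ?_
    rw [div_le_iff₀ (by linarith)] at hl2
    have : A + 1 / 2 * Real.log n ≤ c * Real.log n := by linarith
    calc _ ≤ (n:ℝ) * (c * Real.log n) := mul_le_mul_of_nonneg_left this hn0.le
      _ = _ := by ring
  have hlo : ∀ c : ℝ, c < 1 / 4 → ∀ᶠ n in atTop, c ≤ f n := by
    intro c hc
    set ρ := min (1 / 2) ((1 / 4 - c) * 2) with hρ
    have hρ0 : 0 < ρ := lt_min (by norm_num) (by linarith)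
    have hρ1 : ρ ≤ 1 / 2 := min_le_left _ _
    have hρ2 : ρ ≤ (1 / 4 - c) * 2 := min_le_right _ _
    obtain ⟨A, hA⟩ := lower_asym ha hab hb h1 h2 hρ0 (by linarith)
    have hd : 0 < (1 - ρ) / 4 - c := by linarith
    filter_upwards [hA, eventually_gt_atTop 0, hlogt.eventually_gt_atTop 0,
      hlogt.eventually_ge_atTop (A / ((1 - ρ) / 4 - c))] with n ⟨N', hN'0, hN', hle⟩ hn hl hl2
    have hn0 : (0:ℝ) < n := by exact_mod_cast hn
    have hNN : N' ≤ N n := (hN n).2 hN'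
    have hlogN : Real.log N' ≤ Real.log (N n) :=
      Real.log_le_log (by exact_mod_cast hN'0) (by exact_mod_cast hNN)
    rw [hfe, le_div_iff₀ (by positivity)]
    rw [div_le_iff₀ hd] at hl2
    have : c * Real.log n ≤ (1 - ρ) / 4 * Real.log n - A := by linarith
    calc c * (n * Real.log n) = n * (c * Real.log n) := by ring
      _ ≤ _ := mul_le_mul_of_nonneg_left this hn0.le
      _ ≤ _ := hle.trans hlogN
  have hba : IsBoundedUnder (· ≤ ·) atTop f := ⟨1, hup 1 (by norm_num)⟩
  have hbb : IsBoundedUnder (· ≥ ·) atTop f := ⟨0, hlo 0 (by norm_num)⟩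
  constructor
  · refine le_of_forall_lt_imp_le_of_dense fun c hc => ?_
    exact le_liminf_of_le hba.isCoboundedUnder_ge (hlo c hc)
  · refine le_of_forall_gt_imp_ge_of_dense fun c hc => ?_
    exact limsup_le_of_le hbb.isCoboundedUnder_le (hup c hc)
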